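/- arXiv:0912.5190 — 2 statements merged into one kernel-verified Lean document; each statement's English description precedes it below -/
import Mathlib

section
/- Every homogeneous contact vector field on S^{1|2} is of the form X_h for a contact Hamiltonian h: if X = f∂_x + g₁∂_{ξ₁} + g₂∂_{ξ₂} (with f, g₁, g₂ ∈ A) is a homogeneous vector field such that the supercommutators [X, D̄₁] and [X, D̄₂] both lie in the left A-module generated by D̄₁ and D̄₂ (i.e. [X, D̄ᵢ] = ψᵢ D̄₁ + φᵢ D̄₂ for some ψᵢ, φᵢ ∈ A, i = 1,2), then there exists a homogeneous h ∈ A with X = X_h = h∂_x − (−1)^{p(h)}(1/2)(D̄₁(h)D̄₁ + D̄₂(h)D̄₂); conversely, every operator X_h satisfies this contact condition. -/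
/-!
Functions on the supercircle `S^{1|2}`: the superalgebra
`A = C^∞(ℝ,ℂ)[ξ₁,ξ₂]`.  An element `f = f₀ + ξ₁f₁ + ξ₂f₂ + ξ₁ξ₂f₁₂`
is encoded by the 4-tuple `(f₀, f₁, f₂, f₁₂)` of functions `ℝ → ℂ`.
-/

noncomputable section

abbrev SA : Type := (ℝ → ℂ) × (ℝ → ℂ) × (ℝ → ℂ) × (ℝ → ℂ)

namespace SA

def a0 (f : SA) : ℝ → ℂ := f.1
def a1 (f : SA) : ℝ → ℂ := f.2.1
def a2 (f : SA) : ℝ → ℂ := f.2.2.1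
def a12 (f : SA) : ℝ → ℂ := f.2.2.2

/-- all four component functions are smooth -/
def Smooth (f : SA) : Prop :=
  ContDiff ℝ (⊤ : ℕ∞) (a0 f) ∧ ContDiff ℝ (⊤ : ℕ∞) (a1 f) ∧ ContDiff ℝ (⊤ : ℕ∞) (a2 f) ∧ ContDiff ℝ (⊤ : ℕ∞) (a12 f)

/-- the (super-commutative) product of the Grassmann algebra `A`;
`ξᵢ² = 0`, `ξ₁ξ₂ = -ξ₂ξ₁`. -/
def gmul (f g : SA) : SA :=
  (a0 f * a0 g,
   a0 f * a1 g + a1 f * a0 g,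
   a0 f * a2 g + a2 f * a0 g,
   a0 f * a12 g + a12 f * a0 g + a1 f * a2 g - a2 f * a1 g)

scoped infixl:70 " ⊙ " => SA.gmul

/-- the unit `1 ∈ A` -/
def one : SA := (1, 0, 0, 0)
/-- the even coordinate `x ∈ A` -/
def xx : SA := (fun t => (t : ℂ), 0, 0, 0)
/-- the odd coordinate `ξ₁ ∈ A` -/
def xi1 : SA := (0, 1, 0, 0)
/-- the odd coordinate `ξ₂ ∈ A` -/
def xi2 : SA := (0, 0, 1, 0)

/-- `∂_x`, differentiating the coefficients -/
def dx (f : SA) : SA := (deriv (a0 f), deriv (a1 f), deriv (a2 f), deriv (a12 f))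
/-- the left Grassmann derivative `∂_{ξ₁}` -/
def dxi1 (f : SA) : SA := (a1 f, 0, a12 f, 0)
/-- the left Grassmann derivative `∂_{ξ₂}` -/
def dxi2 (f : SA) : SA := (a2 f, -a12 f, 0, 0)
/-- `D̄₁ = ∂_{ξ₁} - ξ₁∂_x` -/
def D1 (f : SA) : SA := dxi1 f - xi1 ⊙ dx f
/-- `D̄₂ = ∂_{ξ₂} - ξ₂∂_x` -/
def D2 (f : SA) : SA := dxi2 f - xi2 ⊙ dx f

def IsEven (f : SA) : Prop := a1 f = 0 ∧ a2 f = 0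
def IsOdd (f : SA) : Prop := a0 f = 0 ∧ a12 f = 0
/-- `f` is homogeneous of parity `b` (`false` = even, `true` = odd) -/
def Homog (b : Bool) (f : SA) : Prop := if b then IsOdd f else IsEven f
/-- `(-1)^b` -/
def sgn (b : Bool) : ℂ := if b then -1 else 1
/-- `(-1)^(b*c)` -/
def sgn2 (b c : Bool) : ℂ := if b && c then -1 else 1

/-- the contact vector field `X_f` (with `f` homogeneous of parity `b`)
applied to `g`:  `X_f(g) = f ∂_x g - (-1)^{p(f)} ½ (D̄₁(f)D̄₁(g) + D̄₂(f)D̄₂(g))` -/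
def XV (b : Bool) (f : SA) (g : SA) : SA :=
  f ⊙ dx g - (sgn b * (2 : ℂ)⁻¹) • (D1 f ⊙ D1 g + D2 f ⊙ D2 g)

/-- the Lie derivative `L^λ_{X_f} = X_f + λ f'` on `λ`-densities -/
def Lden (b : Bool) (f : SA) (lam : ℂ) (g : SA) : SA :=
  XV b f g + lam • (dx f ⊙ g)

/-- the contact bracket `{f,g} = fg' - f'g - (-1)^{p(f)} ½ (D̄₁(f)D̄₁(g) + D̄₂(f)D̄₂(g))` -/
def cbr (b : Bool) (f g : SA) : SA :=
  f ⊙ dx g - dx f ⊙ g - (sgn b * (2 : ℂ)⁻¹) • (D1 f ⊙ D1 g + D2 f ⊙ D2 g)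

/-- the Lie derivative `𝓛_{X_f}(T) = L^μ_{X_f}∘T - (-1)^{p(f)p(T)} T∘L^λ_{X_f}`
of a homogeneous operator `T` of parity `bT` from `λ`- to `μ`-densities -/
def LieD (bf : Bool) (f : SA) (lam mu : ℂ) (bT : Bool) (T : SA → SA) : SA → SA :=
  fun g => Lden bf f mu (T g) - sgn2 bf bT • T (Lden bf f lam g)

def applyIf (b : Bool) (F : SA → SA) (g : SA) : SA := if b then F g else g

/-- the monomial operator `∂_x^ℓ D̄₁^m D̄₂^n` -/
def monoD (l : ℕ) (m n : Bool) (g : SA) : SA := dx^[l] (applyIf m D1 (applyIf n D2 g))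

def bnat (b : Bool) : ℕ := if b then 1 else 0

/-- membership in `D^{K/2}_{λμ}`: differential operators
`Σ a_{ℓ,m,n} ∂_x^ℓ D̄₁^m D̄₂^n` of contact order `ℓ + m/2 + n/2 ≤ K/2`. -/
def InD (K : ℕ) (T : SA → SA) : Prop :=
  ∃ a : ℕ → Bool → Bool → SA,
    (∀ l m n, Smooth (a l m n)) ∧
    (∀ l m n, ¬ (2 * l + bnat m + bnat n ≤ K) → a l m n = 0) ∧
    (∀ g, Smooth g →
      T g = ∑ l ∈ Finset.range (K + 1), ∑ m : Bool, ∑ n : Bool, a l m n ⊙ monoD l m n g)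

end SA

open SA

/-- a general vector field `X = f∂_x + g₁∂_{ξ₁} + g₂∂_{ξ₂}` on `S^{1|2}` -/
noncomputable def VFop (f g1 g2 : SA) : SA → SA :=
  fun u => f ⊙ dx u + g1 ⊙ dxi1 u + g2 ⊙ dxi2 u

namespace SA

section Components

variable (c : ℂ) (f g : SA)

@[simp] lemma a0_add : a0 (f + g) = a0 f + a0 g := rfl
@[simp] lemma a1_add : a1 (f + g) = a1 f + a1 g := rfl
@[simp] lemma a2_add : a2 (f + g) = a2 f + a2 g := rfl
@[simp] lemma a12_add : a12 (f + g) = a12 f + a12 g := rfl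
@[simp] lemma a0_sub : a0 (f - g) = a0 f - a0 g := rfl
@[simp] lemma a1_sub : a1 (f - g) = a1 f - a1 g := rfl
@[simp] lemma a2_sub : a2 (f - g) = a2 f - a2 g := rfl
@[simp] lemma a12_sub : a12 (f - g) = a12 f - a12 g := rfl
@[simp] lemma a0_neg : a0 (-f) = -a0 f := rfl
@[simp] lemma a1_neg : a1 (-f) = -a1 f := rfl
@[simp] lemma a2_neg : a2 (-f) = -a2 f := rfl
@[simp] lemma a12_neg : a12 (-f) = -a12 f := rfl
@[simp] lemma a0_smul : a0 (c • f) = c • a0 f := rfl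
@[simp] lemma a1_smul : a1 (c • f) = c • a1 f := rfl
@[simp] lemma a2_smul : a2 (c • f) = c • a2 f := rfl
@[simp] lemma a12_smul : a12 (c • f) = c • a12 f := rfl
@[simp] lemma a0_zero : a0 (0 : SA) = 0 := rfl
@[simp] lemma a1_zero : a1 (0 : SA) = 0 := rfl
@[simp] lemma a2_zero : a2 (0 : SA) = 0 := rfl
@[simp] lemma a12_zero : a12 (0 : SA) = 0 := rfl
@[simp] lemma a0_mk (p q r s : ℝ → ℂ) : a0 (p, q, r, s) = p := rfl
@[simp] lemma a1_mk (p q r s : ℝ → ℂ) : a1 (p, q, r, s) = q := rfl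
@[simp] lemma a2_mk (p q r s : ℝ → ℂ) : a2 (p, q, r, s) = r := rfl
@[simp] lemma a12_mk (p q r s : ℝ → ℂ) : a12 (p, q, r, s) = s := rfl

@[simp] lemma a0_one : a0 one = 1 := rfl
@[simp] lemma a1_one : a1 one = 0 := rfl
@[simp] lemma a2_one : a2 one = 0 := rfl
@[simp] lemma a12_one : a12 one = 0 := rfl
@[simp] lemma a0_xi1 : a0 xi1 = 0 := rfl
@[simp] lemma a1_xi1 : a1 xi1 = 1 := rfl
@[simp] lemma a2_xi1 : a2 xi1 = 0 := rfl
@[simp] lemma a12_xi1 : a12 xi1 = 0 := rfl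
@[simp] lemma a0_xi2 : a0 xi2 = 0 := rfl
@[simp] lemma a1_xi2 : a1 xi2 = 0 := rfl
@[simp] lemma a2_xi2 : a2 xi2 = 1 := rfl
@[simp] lemma a12_xi2 : a12 xi2 = 0 := rfl

end Components

lemma ext_components {f g : SA} (h0 : ∀ t, a0 f t = a0 g t) (h1 : ∀ t, a1 f t = a1 g t)
    (h2 : ∀ t, a2 f t = a2 g t) (h12 : ∀ t, a12 f t = a12 g t) : f = g :=
  Prod.ext (funext h0) (Prod.ext (funext h1) (Prod.ext (funext h2) (funext h12)))

section Algebra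

variable (c : ℂ) (f g k : SA)

lemma add_gmul : (f + g) ⊙ k = f ⊙ k + g ⊙ k := by
  apply ext_components <;> intro t <;> simp [gmul] <;> ring

lemma smul_gmul : (c • f) ⊙ g = c • (f ⊙ g) := by
  apply ext_components <;> intro t <;> simp [gmul]
  all_goals ring

lemma gmul_neg : f ⊙ (-g) = -(f ⊙ g) := by
  apply ext_components <;> intro t <;> simp [gmul] <;> ring

lemma gmul_sub : f ⊙ (g - k) = f ⊙ g - f ⊙ k := by
  apply ext_components <;> intro t <;> simp [gmul] <;> ring

lemma gmul_assoc : (f ⊙ g) ⊙ k = f ⊙ (g ⊙ k) := by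
  apply ext_components <;> intro t <;> simp [gmul] <;> ring

@[simp] lemma gmul_one : f ⊙ one = f := by
  apply ext_components <;> intro t <;> simp [gmul]

@[simp] lemma gmul_zero : f ⊙ 0 = 0 := by
  apply ext_components <;> intro t <;> simp [gmul]

end Algebra

section Smoothness

variable {f g : SA}

lemma Smooth.add (hf : Smooth f) (hg : Smooth g) : Smooth (f + g) :=
  ⟨hf.1.add hg.1, hf.2.1.add hg.2.1, hf.2.2.1.add hg.2.2.1, hf.2.2.2.add hg.2.2.2⟩

lemma Smooth.sub (hf : Smooth f) (hg : Smooth g) : Smooth (f - g) :=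
  ⟨hf.1.sub hg.1, hf.2.1.sub hg.2.1, hf.2.2.1.sub hg.2.2.1, hf.2.2.2.sub hg.2.2.2⟩

lemma Smooth.const_smul (c : ℂ) (hf : Smooth f) : Smooth (c • f) :=
  ⟨hf.1.const_smul c, hf.2.1.const_smul c, hf.2.2.1.const_smul c, hf.2.2.2.const_smul c⟩

lemma Smooth.gmul (hf : Smooth f) (hg : Smooth g) : Smooth (f ⊙ g) := by
  obtain ⟨f0, f1, f2, f12⟩ := hf
  obtain ⟨g0, g1, g2, g12⟩ := hg
  exact ⟨f0.mul g0, (f0.mul g1).add (f1.mul g0), (f0.mul g2).add (f2.mul g0),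
    (((f0.mul g12).add (f12.mul g0)).add (f1.mul g2)).sub (f2.mul g1)⟩

lemma Smooth.dx (hf : Smooth f) : Smooth (dx f) :=
  ⟨(contDiff_infty_iff_deriv.1 hf.1).2, (contDiff_infty_iff_deriv.1 hf.2.1).2,
    (contDiff_infty_iff_deriv.1 hf.2.2.1).2, (contDiff_infty_iff_deriv.1 hf.2.2.2).2⟩

lemma Smooth.dxi1 (hf : Smooth f) : Smooth (dxi1 f) :=
  ⟨hf.2.1, contDiff_const, hf.2.2.2, contDiff_const⟩

lemma Smooth.dxi2 (hf : Smooth f) : Smooth (dxi2 f) :=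
  ⟨hf.2.2.1, hf.2.2.2.neg, contDiff_const, contDiff_const⟩

lemma smooth_xi1 : Smooth xi1 := ⟨contDiff_const, contDiff_const, contDiff_const, contDiff_const⟩

lemma smooth_xi2 : Smooth xi2 := ⟨contDiff_const, contDiff_const, contDiff_const, contDiff_const⟩

lemma smooth_xx : Smooth xx :=
  ⟨Complex.ofRealCLM.contDiff, contDiff_const, contDiff_const, contDiff_const⟩

lemma Smooth.D1 (hf : Smooth f) : Smooth (D1 f) := hf.dxi1.sub (smooth_xi1.gmul hf.dx)

lemma Smooth.D2 (hf : Smooth f) : Smooth (D2 f) := hf.dxi2.sub (smooth_xi2.gmul hf.dx)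

lemma Smooth.differentiableAt (hf : Smooth f) (t : ℝ) :
    DifferentiableAt ℝ (a0 f) t ∧ DifferentiableAt ℝ (a1 f) t ∧
      DifferentiableAt ℝ (a2 f) t ∧ DifferentiableAt ℝ (a12 f) t :=
  ⟨hf.1.differentiable (by simp) t, hf.2.1.differentiable (by simp) t,
    hf.2.2.1.differentiable (by simp) t, hf.2.2.2.differentiable (by simp) t⟩

end Smoothness

section Parity

variable {b : Bool} {f g : SA}

lemma Homog.add (hf : Homog b f) (hg : Homog b g) : Homog b (f + g) := by
  cases b <;> simp_all [Homog, IsEven, IsOdd]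

lemma Homog.gmul_xi1 (hf : Homog (!b) f) : Homog b (f ⊙ xi1) := by
  cases b <;> simp_all [Homog, IsEven, IsOdd, gmul, xi1]

lemma Homog.gmul_xi2 (hf : Homog (!b) f) : Homog b (f ⊙ xi2) := by
  cases b <;> simp_all [Homog, IsEven, IsOdd, gmul, xi2]

lemma Homog.D1 (hf : Homog b f) : Homog (!b) (D1 f) := by
  cases b <;> simp_all [Homog, IsEven, IsOdd, SA.D1, SA.dxi1, SA.dx, gmul, xi1]

lemma Homog.D2 (hf : Homog b f) : Homog (!b) (D2 f) := by
  cases b <;> simp_all [Homog, IsEven, IsOdd, SA.D2, SA.dxi2, SA.dx, gmul, xi2]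

lemma sgn_not (b : Bool) : sgn (!b) = -sgn b := by cases b <;> simp [sgn]

end Parity

section Derivations

variable {f g : SA}

lemma dx_add (hf : Smooth f) (hg : Smooth g) : dx (f + g) = dx f + dx g := by
  apply ext_components <;> intro t <;> obtain ⟨f0, f1, f2, f12⟩ := hf.differentiableAt t <;>
    obtain ⟨g0, g1, g2, g12⟩ := hg.differentiableAt t <;> simp [dx, deriv_add, *]

lemma dx_smul (c : ℂ) (hf : Smooth f) : dx (c • f) = c • dx f := by
  apply ext_components <;> intro t <;> obtain ⟨f0, f1, f2, f12⟩ := hf.differentiableAt t <;>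
    simp [dx, deriv_const_smul, *]

lemma dx_gmul (hf : Smooth f) (hg : Smooth g) : dx (f ⊙ g) = dx f ⊙ g + f ⊙ dx g := by
  apply ext_components <;> intro t <;> obtain ⟨f0, f1, f2, f12⟩ := hf.differentiableAt t <;>
    obtain ⟨g0, g1, g2, g12⟩ := hg.differentiableAt t <;>
    simp (maxDischargeDepth := 4) [dx, gmul, deriv_add, deriv_sub, deriv_mul,
      DifferentiableAt.mul, DifferentiableAt.add, *] <;> ring

lemma D1_add (hf : Smooth f) (hg : Smooth g) : D1 (f + g) = D1 f + D1 g := by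
  rw [D1, dx_add hf hg]
  apply ext_components <;> intro t <;> simp [D1, dxi1, gmul] <;> ring

lemma D2_add (hf : Smooth f) (hg : Smooth g) : D2 (f + g) = D2 f + D2 g := by
  rw [D2, dx_add hf hg]
  apply ext_components <;> intro t <;> simp [D2, dxi2, gmul] <;> ring

lemma D1_smul (c : ℂ) (hf : Smooth f) : D1 (c • f) = c • D1 f := by
  rw [D1, dx_smul c hf]
  apply ext_components <;> intro t <;> simp [D1, dxi1, gmul]

lemma D2_smul (c : ℂ) (hf : Smooth f) : D2 (c • f) = c • D2 f := by
  rw [D2, dx_smul c hf]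
  apply ext_components <;> intro t <;> simp [D2, dxi2, gmul]

/-- The super Leibniz rule for `D̄₁`. -/
lemma D1_gmul {b : Bool} (hb : Homog b f) (hf : Smooth f) (hg : Smooth g) :
    D1 (f ⊙ g) = D1 f ⊙ g + sgn b • (f ⊙ D1 g) := by
  rw [D1, dx_gmul hf hg]
  cases b <;> simp only [Homog, IsEven, IsOdd, if_true, Bool.false_eq_true, if_false] at hb <;>
    apply ext_components <;> intro t <;> simp [D1, dxi1, dx, gmul, sgn, hb] <;> ring

/-- The super Leibniz rule for `D̄₂`. -/
lemma D2_gmul {b : Bool} (hb : Homog b f) (hf : Smooth f) (hg : Smooth g) :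
    D2 (f ⊙ g) = D2 f ⊙ g + sgn b • (f ⊙ D2 g) := by
  rw [D2, dx_gmul hf hg]
  cases b <;> simp only [Homog, IsEven, IsOdd, if_true, Bool.false_eq_true, if_false] at hb <;>
    apply ext_components <;> intro t <;> simp [D2, dxi2, dx, gmul, sgn, hb] <;> ring

lemma D1_D1 (f : SA) : D1 (D1 f) = -dx f := by
  apply ext_components <;> intro t <;> simp [D1, dxi1, dx, gmul]

lemma D2_D2 (f : SA) : D2 (D2 f) = -dx f := by
  apply ext_components <;> intro t <;> simp [D2, dxi2, dx, gmul]

lemma D2_D1 (f : SA) : D2 (D1 f) = -D1 (D2 f) := by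
  apply ext_components <;> intro t <;> simp [D1, D2, dxi1, dxi2, dx, gmul]

lemma dx_D1 (f : SA) : dx (D1 f) = D1 (dx f) := by
  apply ext_components <;> intro t <;> simp [D1, dxi1, dx, gmul]

lemma dx_D2 (f : SA) : dx (D2 f) = D2 (dx f) := by
  apply ext_components <;> intro t <;> simp [D2, dxi2, dx, gmul]

end Derivations

section Coordinates

@[simp] lemma D1_xi1 : D1 xi1 = one := by
  apply ext_components <;> intro t <;> simp [D1, show dxi1 xi1 = one from rfl, dx, gmul]

@[simp] lemma D2_xi1 : D2 xi1 = 0 := by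
  apply ext_components <;> intro t <;> simp [D2, dxi2, dx, gmul]

@[simp] lemma D1_xi2 : D1 xi2 = 0 := by
  apply ext_components <;> intro t <;> simp [D1, dxi1, dx, gmul]

@[simp] lemma D2_xi2 : D2 xi2 = one := by
  apply ext_components <;> intro t <;> simp [D2, show dxi2 xi2 = one by simp [dxi2, one], dx, gmul]

lemma dx_xx : dx xx = one := by
  have h (t : ℝ) : deriv (fun s : ℝ => (s : ℂ)) t = 1 := Complex.ofRealCLM.hasDerivAt.deriv
  apply ext_components <;> intro t <;> simp [dx, xx, h]

@[simp] lemma D1_xx : D1 xx = -xi1 := by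
  rw [D1, dx_xx]
  apply ext_components <;> intro t <;> simp [dxi1, xx]

@[simp] lemma D2_xx : D2 xx = -xi2 := by
  rw [D2, dx_xx]
  apply ext_components <;> intro t <;> simp [dxi2, xx]

variable (f g1 g2 : SA)

@[simp] lemma VFop_zero : VFop f g1 g2 0 = 0 := by
  apply ext_components <;> intro t <;> simp [VFop, dx, dxi1, dxi2, gmul]

@[simp] lemma VFop_one : VFop f g1 g2 one = 0 := by
  apply ext_components <;> intro t <;> simp [VFop, dx, dxi1, dxi2, gmul]

@[simp] lemma VFop_xi1 : VFop f g1 g2 xi1 = g1 := by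
  apply ext_components <;> intro t <;> simp [VFop, dx, dxi1, dxi2, gmul]

@[simp] lemma VFop_xi2 : VFop f g1 g2 xi2 = g2 := by
  apply ext_components <;> intro t <;> simp [VFop, dx, dxi1, dxi2, gmul]

@[simp] lemma VFop_neg_xi1 : VFop f g1 g2 (-xi1) = -g1 := by
  apply ext_components <;> intro t <;> simp [VFop, dx, dxi1, dxi2, gmul]

@[simp] lemma VFop_neg_xi2 : VFop f g1 g2 (-xi2) = -g2 := by
  apply ext_components <;> intro t <;> simp [VFop, dx, dxi1, dxi2, gmul]

@[simp] lemma VFop_xx : VFop f g1 g2 xx = f := by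
  rw [VFop, dx_xx]
  apply ext_components <;> intro t <;> simp [dxi1, dxi2, gmul, xx]

end Coordinates

/-- The contact Hamiltonian of `f∂_x + g₁∂_{ξ₁} + g₂∂_{ξ₂}`: its coefficient of `∂_x` in the frame
`∂_x, D̄₁, D̄₂`. -/
def hamiltonian (f g1 g2 : SA) : SA := f + g1 ⊙ xi1 + g2 ⊙ xi2

lemma VFop_eq_frame (f g1 g2 u : SA) :
    VFop f g1 g2 u = hamiltonian f g1 g2 ⊙ dx u + g1 ⊙ D1 u + g2 ⊙ D2 u := by
  simp only [VFop, hamiltonian, D1, D2, add_gmul, gmul_sub, gmul_assoc]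
  abel

section Contact

variable {b : Bool}

lemma VFop_eq_XV {f g1 g2 : SA} (h1 : g1 = -(sgn b * (2 : ℂ)⁻¹) • D1 (hamiltonian f g1 g2))
    (h2 : g2 = -(sgn b * (2 : ℂ)⁻¹) • D2 (hamiltonian f g1 g2)) (u : SA) :
    VFop f g1 g2 u = XV b (hamiltonian f g1 g2) u := by
  rw [VFop_eq_frame, XV]
  generalize hamiltonian f g1 g2 = h at *
  rw [h1, h2, smul_gmul, smul_gmul]
  module

lemma eq_D1_hamiltonian {f g1 g2 ψ φ : SA} (hf : Smooth f) (hg1 : Smooth g1) (hg2 : Smooth g2)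
    (p1 : Homog (!b) g1) (p2 : Homog (!b) g2)
    (H : ∀ u, Smooth u →
      VFop f g1 g2 (D1 u) - sgn b • D1 (VFop f g1 g2 u) = ψ ⊙ D1 u + φ ⊙ D2 u) :
    g1 = -(sgn b * (2 : ℂ)⁻¹) • D1 (hamiltonian f g1 g2) := by
  have hψ := H xi1 smooth_xi1
  have hφ := H xi2 smooth_xi2
  have hx := H xx smooth_xx
  simp only [D1_xi1, D2_xi1, D1_xi2, D2_xi2, VFop_one, VFop_zero, VFop_xi1, VFop_xi2, gmul_one,
    gmul_zero, add_zero, zero_add, zero_sub, ← neg_smul] at hψ hφ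
  rw [← hψ, ← hφ, D1_xx, D2_xx, VFop_neg_xi1, VFop_xx, gmul_neg, gmul_neg, smul_gmul,
    smul_gmul] at hx
  rw [hamiltonian, D1_add (hf.add (hg1.gmul smooth_xi1)) (hg2.gmul smooth_xi2),
    D1_add hf (hg1.gmul smooth_xi1), D1_gmul p1 hg1 smooth_xi1, D1_gmul p2 hg2 smooth_xi2,
    D1_xi1, D1_xi2, gmul_one, gmul_zero, sgn_not]
  cases b <;> simp only [sgn, if_true, Bool.false_eq_true, if_false] at hx ⊢ <;>
    linear_combination (norm := module) (-(2 : ℂ)⁻¹) • hx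

lemma eq_D2_hamiltonian {f g1 g2 ψ φ : SA} (hf : Smooth f) (hg1 : Smooth g1) (hg2 : Smooth g2)
    (p1 : Homog (!b) g1) (p2 : Homog (!b) g2)
    (H : ∀ u, Smooth u →
      VFop f g1 g2 (D2 u) - sgn b • D2 (VFop f g1 g2 u) = ψ ⊙ D1 u + φ ⊙ D2 u) :
    g2 = -(sgn b * (2 : ℂ)⁻¹) • D2 (hamiltonian f g1 g2) := by
  have hψ := H xi1 smooth_xi1
  have hφ := H xi2 smooth_xi2
  have hx := H xx smooth_xx
  simp only [D1_xi1, D2_xi1, D1_xi2, D2_xi2, VFop_one, VFop_zero, VFop_xi1, VFop_xi2, gmul_one,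
    gmul_zero, add_zero, zero_add, zero_sub, ← neg_smul] at hψ hφ
  rw [← hψ, ← hφ, D1_xx, D2_xx, VFop_neg_xi2, VFop_xx, gmul_neg, gmul_neg, smul_gmul,
    smul_gmul] at hx
  rw [hamiltonian, D2_add (hf.add (hg1.gmul smooth_xi1)) (hg2.gmul smooth_xi2),
    D2_add hf (hg1.gmul smooth_xi1), D2_gmul p1 hg1 smooth_xi1, D2_gmul p2 hg2 smooth_xi2,
    D2_xi1, D2_xi2, gmul_one, gmul_zero, sgn_not]
  cases b <;> simp only [sgn, if_true, Bool.false_eq_true, if_false] at hx ⊢ <;>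
    linear_combination (norm := module) (-(2 : ℂ)⁻¹) • hx

lemma XV_eq_add (b : Bool) (h u : SA) :
    XV b h u = h ⊙ dx u + (-(sgn b * (2 : ℂ)⁻¹)) • (D1 h ⊙ D1 u + D2 h ⊙ D2 u) := by
  rw [XV, neg_smul, sub_eq_add_neg]

/-- `[X_h, D̄₁] = ½ (D̄₁D̄₁(h) D̄₁ + D̄₁D̄₂(h) D̄₂)`. -/
lemma commutator_XV_D1 {h u : SA} (hh : Smooth h) (hb : Homog b h) (hu : Smooth u) :
    XV b h (D1 u) - sgn b • D1 (XV b h u) =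
      ((2 : ℂ)⁻¹ • D1 (D1 h)) ⊙ D1 u + ((2 : ℂ)⁻¹ • D1 (D2 h)) ⊙ D2 u := by
  have s1 := hh.D1.gmul hu.D1
  have s2 := hh.D2.gmul hu.D2
  rw [XV_eq_add b h u, D1_add (hh.gmul hu.dx) ((s1.add s2).const_smul _),
    D1_smul _ (s1.add s2), D1_add s1 s2, D1_gmul hb hh hu.dx, D1_gmul hb.D1 hh.D1 hu.D1,
    D1_gmul hb.D2 hh.D2 hu.D2, XV, dx_D1, D2_D1 u, D1_D1 u]
  simp only [smul_gmul, gmul_neg, sgn_not]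
  cases b <;> simp only [sgn, if_true, Bool.false_eq_true, if_false] <;> module

/-- `[X_h, D̄₂] = ½ (D̄₂D̄₁(h) D̄₁ + D̄₂D̄₂(h) D̄₂)`. -/
lemma commutator_XV_D2 {h u : SA} (hh : Smooth h) (hb : Homog b h) (hu : Smooth u) :
    XV b h (D2 u) - sgn b • D2 (XV b h u) =
      ((2 : ℂ)⁻¹ • D2 (D1 h)) ⊙ D1 u + ((2 : ℂ)⁻¹ • D2 (D2 h)) ⊙ D2 u := by
  have s1 := hh.D1.gmul hu.D1
  have s2 := hh.D2.gmul hu.D2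
  rw [XV_eq_add b h u, D2_add (hh.gmul hu.dx) ((s1.add s2).const_smul _),
    D2_smul _ (s1.add s2), D2_add s1 s2, D2_gmul hb hh hu.dx, D2_gmul hb.D1 hh.D1 hu.D1,
    D2_gmul hb.D2 hh.D2 hu.D2, XV, dx_D2, D2_D1 u, D2_D2 u]
  simp only [smul_gmul, gmul_neg, sgn_not]
  cases b <;> simp only [sgn, if_true, Bool.false_eq_true, if_false] <;> module

end Contact

end SA

/-- A homogeneous vector field preserves the contact
distribution `⟨D̄₁, D̄₂⟩` (i.e. both supercommutators `[X, D̄ᵢ]` lie in the left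
`A`-module generated by `D̄₁, D̄₂`) if and only if it is of the form `X_h` for a
homogeneous contact Hamiltonian `h ∈ A`. -/
theorem statement0 :
    (∀ (b : Bool) (f g1 g2 : SA), Smooth f → Smooth g1 → Smooth g2 →
      Homog b f → Homog (!b) g1 → Homog (!b) g2 →
      (∃ ψ1 φ1 ψ2 φ2 : SA, Smooth ψ1 ∧ Smooth φ1 ∧ Smooth ψ2 ∧ Smooth φ2 ∧
        (∀ u, Smooth u →
          VFop f g1 g2 (D1 u) - sgn b • D1 (VFop f g1 g2 u) = ψ1 ⊙ D1 u + φ1 ⊙ D2 u) ∧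
        (∀ u, Smooth u →
          VFop f g1 g2 (D2 u) - sgn b • D2 (VFop f g1 g2 u) = ψ2 ⊙ D1 u + φ2 ⊙ D2 u)) →
      ∃ h : SA, Smooth h ∧ Homog b h ∧ ∀ u, Smooth u → VFop f g1 g2 u = XV b h u) ∧
    (∀ (b : Bool) (h : SA), Smooth h → Homog b h →
      ∃ ψ1 φ1 ψ2 φ2 : SA, Smooth ψ1 ∧ Smooth φ1 ∧ Smooth ψ2 ∧ Smooth φ2 ∧
        (∀ u, Smooth u →
          XV b h (D1 u) - sgn b • D1 (XV b h u) = ψ1 ⊙ D1 u + φ1 ⊙ D2 u) ∧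
        (∀ u, Smooth u →
          XV b h (D2 u) - sgn b • D2 (XV b h u) = ψ2 ⊙ D1 u + φ2 ⊙ D2 u)) := by
  refine ⟨?_, fun b h hh hb => ⟨_, _, _, _, hh.D1.D1.const_smul _, hh.D2.D1.const_smul _,
    hh.D1.D2.const_smul _, hh.D2.D2.const_smul _, fun u hu => commutator_XV_D1 hh hb hu,
    fun u hu => commutator_XV_D2 hh hb hu⟩⟩
  rintro b f g1 g2 hf hg1 hg2 pf p1 p2 ⟨ψ1, φ1, ψ2, φ2, -, -, -, -, H1, H2⟩
  exact ⟨hamiltonian f g1 g2, (hf.add (hg1.gmul smooth_xi1)).add (hg2.gmul smooth_xi2),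
    (pf.add p1.gmul_xi1).add p2.gmul_xi2, fun u _ =>
      VFop_eq_XV (eq_D1_hamiltonian hf hg1 hg2 p1 p2 H1) (eq_D2_hamiltonian hf hg1 hg2 p1 p2 H2) u⟩
end
end

section
/- For all homogeneous f, g ∈ A the supercommutator of contact vector fields satisfies [X_f, X_g] = X_f∘X_g − (−1)^{p(f)p(g)} X_g∘X_f = X_{{f,g}}, where {f,g} is the contact bracket; consequently the contact bracket is superskew-symmetric ({f,g} = −(−1)^{p(f)p(g)}{g,f}) and satisfies the super Jacobi identity, so that (A, {·,·}) is a Lie superalgebra (denoted K(2)). -/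
/-!
Functions on the supercircle `S^{1|2}`: the superalgebra
`A = C^∞(ℝ,ℂ)[ξ₁,ξ₂]`.  An element `f = f₀ + ξ₁f₁ + ξ₂f₂ + ξ₁ξ₂f₁₂`
is encoded by the 4-tuple `(f₀, f₁, f₂, f₁₂)` of functions `ℝ → ℂ`.
-/

noncomputable section

namespace SA

scoped infixl:70 " ⊙ " => SA.gmul

end SA

open SA

section SmoothFunctions

variable {p q : ℝ → ℂ}

theorem ContDiff.deriv_top (hp : ContDiff ℝ (⊤ : ℕ∞) p) : ContDiff ℝ (⊤ : ℕ∞) (deriv p) :=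
  (contDiff_infty_iff_deriv.1 hp).2

theorem ContDiff.deriv_mul_top (hp : ContDiff ℝ (⊤ : ℕ∞) p) (hq : ContDiff ℝ (⊤ : ℕ∞) q) :
    deriv (p * q) = deriv p * q + p * deriv q := by
  funext x
  exact deriv_mul (hp.differentiable (by simp) x) (hq.differentiable (by simp) x)

theorem ContDiff.deriv_add_top (hp : ContDiff ℝ (⊤ : ℕ∞) p) (hq : ContDiff ℝ (⊤ : ℕ∞) q) :
    deriv (p + q) = deriv p + deriv q := by
  funext x
  exact deriv_add (hp.differentiable (by simp) x) (hq.differentiable (by simp) x)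

theorem ContDiff.deriv_sub_top (hp : ContDiff ℝ (⊤ : ℕ∞) p) (hq : ContDiff ℝ (⊤ : ℕ∞) q) :
    deriv (p - q) = deriv p - deriv q := by
  funext x
  exact deriv_sub (hp.differentiable (by simp) x) (hq.differentiable (by simp) x)

theorem deriv_neg_pi (p : ℝ → ℂ) : deriv (-p) = -deriv p := by
  funext x
  exact deriv.neg

theorem ContDiff.deriv_const_smul_top (c : ℂ) (hp : ContDiff ℝ (⊤ : ℕ∞) p) :
    deriv (c • p) = c • deriv p := by
  funext x
  exact deriv_const_smul c (hp.differentiable (by simp) x)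

theorem ContDiff.add_top (hp : ContDiff ℝ (⊤ : ℕ∞) p) (hq : ContDiff ℝ (⊤ : ℕ∞) q) :
    ContDiff ℝ (⊤ : ℕ∞) (p + q) := hp.add hq

theorem ContDiff.sub_top (hp : ContDiff ℝ (⊤ : ℕ∞) p) (hq : ContDiff ℝ (⊤ : ℕ∞) q) :
    ContDiff ℝ (⊤ : ℕ∞) (p - q) := hp.sub hq

theorem ContDiff.neg_top (hp : ContDiff ℝ (⊤ : ℕ∞) p) : ContDiff ℝ (⊤ : ℕ∞) (-p) := hp.neg

theorem ContDiff.mul_top (hp : ContDiff ℝ (⊤ : ℕ∞) p) (hq : ContDiff ℝ (⊤ : ℕ∞) q) :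
    ContDiff ℝ (⊤ : ℕ∞) (p * q) := hp.mul hq

theorem ContDiff.const_smul_top (c : ℂ) (hp : ContDiff ℝ (⊤ : ℕ∞) p) :
    ContDiff ℝ (⊤ : ℕ∞) (c • p) := contDiff_const.smul hp

theorem deriv_zero_pi : deriv (0 : ℝ → ℂ) = 0 := by
  funext x
  exact deriv_const x (0 : ℂ)

end SmoothFunctions

namespace SA

set_option maxHeartbeats 2000000 in
theorem contact_commutator (bf bg : Bool) (f g : SA) (hf : Smooth f) (hg : Smooth g)
    (pf : Homog bf f) (pg : Homog bg g) (u : SA) (hu : Smooth u) :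
    XV bf f (XV bg g u) - sgn2 bf bg • XV bg g (XV bf f u)
      = XV (xor bf bg) (cbr bf f g) u := by
  obtain ⟨f0, f1, f2, f3⟩ := f
  obtain ⟨g0, g1, g2, g3⟩ := g
  obtain ⟨u0, u1, u2, u3⟩ := u
  obtain ⟨hf0, hf1, hf2, hf3⟩ := hf
  obtain ⟨hg0, hg1, hg2, hg3⟩ := hg
  obtain ⟨hu0, hu1, hu2, hu3⟩ := hu
  simp only [a0, a1, a2, a12] at hf0 hf1 hf2 hf3 hg0 hg1 hg2 hg3 hu0 hu1 hu2 hu3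
  cases bf <;> cases bg <;> obtain ⟨rfl, rfl⟩ := pf <;> obtain ⟨rfl, rfl⟩ := pg <;>
  · simp (disch := repeat' first
        | assumption
        | with_reducible apply ContDiff.deriv_top
        | with_reducible apply ContDiff.mul_top
        | with_reducible apply ContDiff.add_top
        | with_reducible apply ContDiff.sub_top
        | with_reducible apply ContDiff.neg_top
        | with_reducible apply ContDiff.const_smul_top)
      only [XV, cbr, D1, D2, dx, dxi1, dxi2, gmul, a0, a1, a2, a12, xi1, xi2, sgn, sgn2,
      Prod.mk_add_mk, Prod.mk_sub_mk, Prod.smul_mk, Prod.mk.injEq, mul_zero, zero_mul, add_zero,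
      zero_add, sub_zero, zero_sub, one_mul, neg_zero, smul_zero, deriv_zero_pi,
      ContDiff.deriv_mul_top, ContDiff.deriv_add_top, ContDiff.deriv_sub_top,
      deriv_neg_pi, ContDiff.deriv_const_smul_top]
    refine ⟨?_, ?_, ?_, ?_⟩ <;> funext x <;>
      simp [smul_eq_mul] <;> ring

theorem contact_bracket_skew (bf bg : Bool) (f g : SA)
    (pf : Homog bf f) (pg : Homog bg g) :
    cbr bf f g = -(sgn2 bf bg • cbr bg g f) := by
  obtain ⟨f0, f1, f2, f3⟩ := f
  obtain ⟨g0, g1, g2, g3⟩ := g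
  cases bf <;> cases bg <;> obtain ⟨rfl, rfl⟩ := pf <;> obtain ⟨rfl, rfl⟩ := pg <;>
  · simp only [cbr, D1, D2, dx, dxi1, dxi2, gmul, a0, a1, a2, a12, xi1, xi2, sgn, sgn2,
      Prod.mk_add_mk, Prod.mk_sub_mk, Prod.smul_mk, Prod.neg_mk, Prod.mk.injEq, deriv_zero_pi]
    refine ⟨?_, ?_, ?_, ?_⟩ <;> funext x <;>
      simp [smul_eq_mul] <;> ring

set_option maxHeartbeats 2000000 in
theorem contact_bracket_jacobi (bf bg bh : Bool) (f g h : SA) (hf : Smooth f) (hg : Smooth g)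
    (hh : Smooth h) (pf : Homog bf f) (pg : Homog bg g) (ph : Homog bh h) :
    sgn2 bf bh • cbr bf f (cbr bg g h) + sgn2 bg bf • cbr bg g (cbr bh h f)
      + sgn2 bh bg • cbr bh h (cbr bf f g) = 0 := by
  obtain ⟨f0, f1, f2, f3⟩ := f
  obtain ⟨g0, g1, g2, g3⟩ := g
  obtain ⟨h0, h1, h2, h3⟩ := h
  obtain ⟨hf0, hf1, hf2, hf3⟩ := hf
  obtain ⟨hg0, hg1, hg2, hg3⟩ := hg
  obtain ⟨hh0, hh1, hh2, hh3⟩ := hh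
  simp only [a0, a1, a2, a12] at hf0 hf1 hf2 hf3 hg0 hg1 hg2 hg3 hh0 hh1 hh2 hh3
  cases bf <;> cases bg <;> cases bh <;> obtain ⟨rfl, rfl⟩ := pf <;> obtain ⟨rfl, rfl⟩ := pg <;>
    obtain ⟨rfl, rfl⟩ := ph <;>
  · simp (disch := repeat' first
        | assumption
        | with_reducible apply ContDiff.deriv_top
        | with_reducible apply ContDiff.mul_top
        | with_reducible apply ContDiff.add_top
        | with_reducible apply ContDiff.sub_top
        | with_reducible apply ContDiff.neg_top
        | with_reducible apply ContDiff.const_smul_top)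
      only [cbr, D1, D2, dx, dxi1, dxi2, gmul, a0, a1, a2, a12, xi1, xi2, sgn, sgn2,
      Prod.mk_add_mk, Prod.mk_sub_mk, Prod.smul_mk, Prod.mk_eq_zero, mul_zero, zero_mul, add_zero,
      zero_add, sub_zero, zero_sub, one_mul, neg_zero, smul_zero, deriv_zero_pi,
      ContDiff.deriv_mul_top, ContDiff.deriv_add_top, ContDiff.deriv_sub_top,
      deriv_neg_pi, ContDiff.deriv_const_smul_top]
    refine ⟨?_, ?_, ?_, ?_⟩ <;> first
      | trivial
      | funext x
        simp [smul_eq_mul]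
        ring

end SA

/-- `[X_f, X_g] = X_{{f,g}}`; moreover the contact bracket is
superskew-symmetric and satisfies the super Jacobi identity, so that
`(A, {·,·})` is a Lie superalgebra (denoted `K(2)`). -/
theorem statement1 :
    (∀ (bf bg : Bool) (f g : SA), Smooth f → Smooth g → Homog bf f → Homog bg g →
      ∀ u, Smooth u →
        XV bf f (XV bg g u) - sgn2 bf bg • XV bg g (XV bf f u)
          = XV (xor bf bg) (cbr bf f g) u) ∧
    (∀ (bf bg : Bool) (f g : SA), Smooth f → Smooth g → Homog bf f → Homog bg g →
      cbr bf f g = -(sgn2 bf bg • cbr bg g f)) ∧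
    (∀ (bf bg bh : Bool) (f g h : SA), Smooth f → Smooth g → Smooth h →
      Homog bf f → Homog bg g → Homog bh h →
      sgn2 bf bh • cbr bf f (cbr bg g h) + sgn2 bg bf • cbr bg g (cbr bh h f)
        + sgn2 bh bg • cbr bh h (cbr bf f g) = 0) := by
  exact ⟨contact_commutator, fun bf bg f g _ _ => contact_bracket_skew bf bg f g,
    contact_bracket_jacobi⟩
end
end
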